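/- The Jammes-type constants with combined constraint and with boundary-measure constraint satisfy h̄_J ≤ h̃_J. -/

import Mathlib

open MeasureTheory Set ENNReal

noncomputable section

/-- Weighted integral `∫_S w dμ`, valued in `[0,∞]`. -/
def wInt {d : ℕ} (μ : Measure (EuclideanSpace ℝ (Fin d)))
    (w : EuclideanSpace ℝ (Fin d) → ℝ) (S : Set (EuclideanSpace ℝ (Fin d))) : ℝ≥0∞ :=
  ∫⁻ x in S, ENNReal.ofReal (w x) ∂μ

/-- `s`-dimensional Hausdorff measure on `ℝ^d`. -/
def Hm (d : ℕ) (s : ℝ) : Measure (EuclideanSpace ℝ (Fin d)) :=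
  MeasureTheory.Measure.hausdorffMeasure s

/-- The surface measure `σ`: `(d-1)`-dimensional Hausdorff measure restricted to `∂Ω`. -/
def sigmaM (d : ℕ) (Om : Set (EuclideanSpace ℝ (Fin d))) : Measure (EuclideanSpace ℝ (Fin d)) :=
  (Hm d ((d : ℝ) - 1)).restrict (frontier Om)

/-- `|A|_α := ∫_A α dλ`. -/
def volW {d : ℕ} (α : EuclideanSpace ℝ (Fin d) → ℝ) (A : Set (EuclideanSpace ℝ (Fin d))) : ℝ≥0∞ :=
  wInt volume α A

/-- `∫_S β dσ` for subsets of `∂Ω`. -/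
def bdW {d : ℕ} (Om : Set (EuclideanSpace ℝ (Fin d))) (β : EuclideanSpace ℝ (Fin d) → ℝ)
    (S : Set (EuclideanSpace ℝ (Fin d))) : ℝ≥0∞ :=
  wInt (sigmaM d Om) β S

/-- Internal boundary `∂_I A := frontier A ∩ interior Ω`. -/
def intB {d : ℕ} (Om A : Set (EuclideanSpace ℝ (Fin d))) : Set (EuclideanSpace ℝ (Fin d)) :=
  frontier A ∩ interior Om

/-- External boundary `∂_E A := closure A ∩ ∂Ω`. -/
def extB {d : ℕ} (Om A : Set (EuclideanSpace ℝ (Fin d))) : Set (EuclideanSpace ℝ (Fin d)) :=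
  closure A ∩ frontier Om

/-- `|∂_I A|_α := ∫_{∂_I A} α dH^{d-1}`. -/
def intBW {d : ℕ} (Om : Set (EuclideanSpace ℝ (Fin d))) (α : EuclideanSpace ℝ (Fin d) → ℝ)
    (A : Set (EuclideanSpace ℝ (Fin d))) : ℝ≥0∞ :=
  wInt (Hm d ((d : ℝ) - 1)) α (intB Om A)

/-- `|∂_E A|_β := ∫_{∂_E A} β dσ`. -/
def extBW {d : ℕ} (Om : Set (EuclideanSpace ℝ (Fin d))) (β : EuclideanSpace ℝ (Fin d) → ℝ)
    (A : Set (EuclideanSpace ℝ (Fin d))) : ℝ≥0∞ :=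
  bdW Om β (extB Om A)

/-- Frontier of `S` in the subspace topology of `F`, as a subset of the ambient space:
`closure S ∩ closure (F \ S) ∩ F` (relative closure of `S` intersected with the
relative closure of its relative complement). -/
def relFrontier {X : Type*} [TopologicalSpace X] (F S : Set X) : Set X :=
  closure S ∩ closure (F \ S) ∩ F

/-- `|∂∂_E A|_β := ∫_{∂∂_E A} β dH^{d-2}`, where `∂∂_E A` is the frontier of `∂_E A` in the
subspace topology of `∂Ω`. -/
def ddEW {d : ℕ} (Om : Set (EuclideanSpace ℝ (Fin d))) (β : EuclideanSpace ℝ (Fin d) → ℝ)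
    (A : Set (EuclideanSpace ℝ (Fin d))) : ℝ≥0∞ :=
  wInt (Hm d ((d : ℝ) - 2)) β (relFrontier (frontier Om) (extB Om A))

/-- `A ⊆ Ω` is admissible if it is Borel and `∫_{closure A ∩ closure (Ω \ A) ∩ ∂Ω} β dσ = 0`. -/
def Admissible {d : ℕ} (Om : Set (EuclideanSpace ℝ (Fin d))) (β : EuclideanSpace ℝ (Fin d) → ℝ)
    (A : Set (EuclideanSpace ℝ (Fin d))) : Prop :=
  MeasurableSet A ∧ bdW Om β (closure A ∩ closure (Om \ A) ∩ frontier Om) = 0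

/-- `h_C`: volume constraint `0 < |A|_α ≤ |Ω|_α/2`. -/
def hC {d : ℕ} (Om : Set (EuclideanSpace ℝ (Fin d))) (α β : EuclideanSpace ℝ (Fin d) → ℝ) : ℝ≥0∞ :=
  sInf {r | ∃ A, A ⊆ Om ∧ Admissible Om β A ∧ 0 < volW α A ∧ volW α A ≤ volW α Om / 2 ∧
    r = intBW Om α A / volW α A}

/-- `h̃_C`: boundary-measure constraint `|∂_E A|_β ≤ |∂Ω|_β/2`. -/
def hCt {d : ℕ} (Om : Set (EuclideanSpace ℝ (Fin d))) (α β : EuclideanSpace ℝ (Fin d) → ℝ) : ℝ≥0∞ :=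
  sInf {r | ∃ A, A ⊆ Om ∧ Admissible Om β A ∧ 0 < volW α A ∧
    extBW Om β A ≤ bdW Om β (frontier Om) / 2 ∧ r = intBW Om α A / volW α A}

/-- `h̄_C`: combined constraint `|A|_α + |∂_E A|_β ≤ 1/2`. -/
def hCb {d : ℕ} (Om : Set (EuclideanSpace ℝ (Fin d))) (α β : EuclideanSpace ℝ (Fin d) → ℝ) : ℝ≥0∞ :=
  sInf {r | ∃ A, A ⊆ Om ∧ Admissible Om β A ∧ 0 < volW α A ∧
    volW α A + extBW Om β A ≤ 1 / 2 ∧ r = intBW Om α A / volW α A}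

/-- `h_J`: Jammes constant with volume constraint. -/
def hJ {d : ℕ} (Om : Set (EuclideanSpace ℝ (Fin d))) (α β : EuclideanSpace ℝ (Fin d) → ℝ) : ℝ≥0∞ :=
  sInf {r | ∃ A, A ⊆ Om ∧ Admissible Om β A ∧ 0 < extBW Om β A ∧ volW α A ≤ volW α Om / 2 ∧
    r = intBW Om α A / extBW Om β A}

/-- `h̃_J`: Jammes constant with boundary-measure constraint. -/
def hJt {d : ℕ} (Om : Set (EuclideanSpace ℝ (Fin d))) (α β : EuclideanSpace ℝ (Fin d) → ℝ) : ℝ≥0∞ :=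
  sInf {r | ∃ A, A ⊆ Om ∧ Admissible Om β A ∧ 0 < extBW Om β A ∧
    extBW Om β A ≤ bdW Om β (frontier Om) / 2 ∧ r = intBW Om α A / extBW Om β A}

/-- `h̄_J`: Jammes constant with combined constraint. -/
def hJb {d : ℕ} (Om : Set (EuclideanSpace ℝ (Fin d))) (α β : EuclideanSpace ℝ (Fin d) → ℝ) : ℝ≥0∞ :=
  sInf {r | ∃ A, A ⊆ Om ∧ Admissible Om β A ∧ 0 < extBW Om β A ∧
    volW α A + extBW Om β A ≤ 1 / 2 ∧ r = intBW Om α A / extBW Om β A}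

/-- `h_B`: bulk-boundary constant with volume constraint. -/
def hB {d : ℕ} (Om : Set (EuclideanSpace ℝ (Fin d))) (α β : EuclideanSpace ℝ (Fin d) → ℝ) : ℝ≥0∞ :=
  sInf {r | ∃ A, A ⊆ Om ∧ Admissible Om β A ∧ 0 < volW α A + extBW Om β A ∧
    volW α A ≤ volW α Om / 2 ∧ r = intBW Om α A / (volW α A + extBW Om β A)}

/-- `h̃_B`: bulk-boundary constant with boundary-measure constraint. -/
def hBt {d : ℕ} (Om : Set (EuclideanSpace ℝ (Fin d))) (α β : EuclideanSpace ℝ (Fin d) → ℝ) : ℝ≥0∞ :=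
  sInf {r | ∃ A, A ⊆ Om ∧ Admissible Om β A ∧ 0 < volW α A + extBW Om β A ∧
    extBW Om β A ≤ bdW Om β (frontier Om) / 2 ∧ r = intBW Om α A / (volW α A + extBW Om β A)}

/-- `h̄_B`: bulk-boundary constant with combined constraint. -/
def hBb {d : ℕ} (Om : Set (EuclideanSpace ℝ (Fin d))) (α β : EuclideanSpace ℝ (Fin d) → ℝ) : ℝ≥0∞ :=
  sInf {r | ∃ A, A ⊆ Om ∧ Admissible Om β A ∧ 0 < volW α A + extBW Om β A ∧
    volW α A + extBW Om β A ≤ 1 / 2 ∧ r = intBW Om α A / (volW α A + extBW Om β A)}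

/-- `h̃_E`. -/
def hEt {d : ℕ} (Om : Set (EuclideanSpace ℝ (Fin d))) (α β : EuclideanSpace ℝ (Fin d) → ℝ) : ℝ≥0∞ :=
  sInf {r | ∃ B, B ⊆ Om ∧ Admissible Om β B ∧ 0 < volW α B + extBW Om β B ∧
    extBW Om β B ≤ bdW Om β (frontier Om) / 2 ∧
    r = (intBW Om α B + ddEW Om β B) / (volW α B + extBW Om β B)}

/-- `h̄_D`: Wentzell-type constant with combined constraints. -/
def hDb {d : ℕ} (Om : Set (EuclideanSpace ℝ (Fin d))) (α β : EuclideanSpace ℝ (Fin d) → ℝ) : ℝ≥0∞ :=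
  sInf {r | ∃ A B C, A ⊆ Om ∧ B ⊆ Om ∧ C ⊆ Om ∧
    Admissible Om β A ∧ Admissible Om β B ∧ Admissible Om β C ∧
    volW α A + extBW Om β A ≤ 1 / 2 ∧ volW α B + extBW Om β B ≤ 1 / 2 ∧
    volW α C + extBW Om β C ≤ 1 / 2 ∧
    0 < volW α A ∧ 0 < volW α B + extBW Om β B ∧ 0 < extBW Om β C ∧
    r = intBW Om α A / volW α A * (intBW Om α B / (volW α B + extBW Om β B)) +
        ddEW Om β B / (volW α B + extBW Om β B) * (ddEW Om β C / extBW Om β C)}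

/-- `h̃_D`: Wentzell-type constant with boundary-measure constraints. -/
def hDt {d : ℕ} (Om : Set (EuclideanSpace ℝ (Fin d))) (α β : EuclideanSpace ℝ (Fin d) → ℝ) : ℝ≥0∞ :=
  sInf {r | ∃ A B C, A ⊆ Om ∧ B ⊆ Om ∧ C ⊆ Om ∧
    Admissible Om β A ∧ Admissible Om β B ∧ Admissible Om β C ∧
    extBW Om β A ≤ bdW Om β (frontier Om) / 2 ∧ extBW Om β B ≤ bdW Om β (frontier Om) / 2 ∧
    extBW Om β C ≤ bdW Om β (frontier Om) / 2 ∧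
    0 < volW α A ∧ 0 < volW α B + extBW Om β B ∧ 0 < extBW Om β C ∧
    r = intBW Om α A / volW α A * (intBW Om α B / (volW α B + extBW Om β B)) +
        ddEW Om β B / (volW α B + extBW Om β B) * (ddEW Om β C / extBW Om β C)}

/-- Cheeger constant of the boundary `h_C(∂Ω)`. -/
def hCbd {d : ℕ} (Om : Set (EuclideanSpace ℝ (Fin d))) (β : EuclideanSpace ℝ (Fin d) → ℝ) : ℝ≥0∞ :=
  sInf {r | ∃ C, C ⊆ frontier Om ∧ MeasurableSet C ∧ 0 < bdW Om β C ∧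
    bdW Om β C ≤ bdW Om β (frontier Om) / 2 ∧
    r = wInt (Hm d ((d : ℝ) - 2)) β (relFrontier (frontier Om) C) / bdW Om β C}

/-- Tangential gradient `∇^τ f(x) = ∇f(x) - ⟨∇f(x), N(x)⟩ N(x)` with `N = ∇φ/‖∇φ‖`. -/
def tGrad {d : ℕ} (φ f : EuclideanSpace ℝ (Fin d) → ℝ) (x : EuclideanSpace ℝ (Fin d)) :
    EuclideanSpace ℝ (Fin d) :=
  gradient f x -
    (inner ℝ (gradient f x) ((‖gradient φ x‖)⁻¹ • gradient φ x) : ℝ) •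
      ((‖gradient φ x‖)⁻¹ • gradient φ x)

lemma bdW_eq_withDensity {d : ℕ} (Om : Set (EuclideanSpace ℝ (Fin d)))
    (β : EuclideanSpace ℝ (Fin d) → ℝ) {S : Set (EuclideanSpace ℝ (Fin d))}
    (hS : MeasurableSet S) :
    bdW Om β S = (sigmaM d Om).withDensity (fun x => ENNReal.ofReal (β x)) S :=
  (withDensity_apply _ hS).symm

lemma volW_add_volW_diff {d : ℕ} (α : EuclideanSpace ℝ (Fin d) → ℝ)
    {Om A : Set (EuclideanSpace ℝ (Fin d))} (hA : MeasurableSet A) (hAO : A ⊆ Om) :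
    volW α A + volW α (Om \ A) = volW α Om := by
  have h := lintegral_inter_add_sdiff (μ := volume) (fun x => ENNReal.ofReal (α x)) Om hA
  rwa [inter_eq_self_of_subset_right hAO] at h

lemma Admissible.diff {d : ℕ} {Om A : Set (EuclideanSpace ℝ (Fin d))}
    {β : EuclideanSpace ℝ (Fin d) → ℝ} (hOm : MeasurableSet Om) (hAO : A ⊆ Om)
    (hA : Admissible Om β A) : Admissible Om β (Om \ A) := by
  refine ⟨hOm.diff hA.1, ?_⟩
  rw [sdiff_sdiff_eq_self hAO, inter_comm (closure (Om \ A))]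
  exact hA.2

lemma extBW_add_extBW_diff {d : ℕ} {Om A : Set (EuclideanSpace ℝ (Fin d))}
    {β : EuclideanSpace ℝ (Fin d) → ℝ} (hOm : IsClosed Om) (hAO : A ⊆ Om)
    (hA : Admissible Om β A) :
    extBW Om β A + extBW Om β (Om \ A) = bdW Om β (frontier Om) := by
  have hmE (B : Set (EuclideanSpace ℝ (Fin d))) : MeasurableSet (extB Om B) :=
    (isClosed_closure.inter isClosed_frontier).measurableSet
  have hunion : extB Om A ∪ extB Om (Om \ A) = frontier Om := by
    rw [extB, extB, ← union_inter_distrib_right, ← closure_union, union_sdiff_cancel hAO,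
      hOm.closure_eq, inter_eq_right]
    exact hOm.frontier_subset
  have hinter : extB Om A ∩ extB Om (Om \ A) =
      closure A ∩ closure (Om \ A) ∩ frontier Om :=
    (inter_inter_distrib_right _ _ _).symm
  have hnull := hA.2
  rw [← hinter, bdW_eq_withDensity _ _ ((hmE A).inter (hmE _))] at hnull
  rw [extBW, extBW, bdW_eq_withDensity _ _ (hmE _), bdW_eq_withDensity _ _ (hmE _),
    bdW_eq_withDensity _ _ isClosed_frontier.measurableSet,
    ← measure_union_add_inter _ (hmE _), hnull, add_zero, hunion]

lemma intB_diff {d : ℕ} (Om A : Set (EuclideanSpace ℝ (Fin d))) :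
    intB Om (Om \ A) = intB Om A := by
  have h := frontier_inter_open_inter (s := Aᶜ) (isOpen_interior (s := Om))
  have h' := frontier_inter_open_inter (s := Om \ A) (isOpen_interior (s := Om))
  rw [frontier_compl] at h
  have heq : (Om \ A) ∩ interior Om = Aᶜ ∩ interior Om := by
    ext x
    exact ⟨fun hx => ⟨hx.1.2, hx.2⟩, fun hx => ⟨⟨interior_subset hx.2, hx.1⟩, hx.2⟩⟩
  rw [intB, intB, ← h', heq, h]

theorem stmt_3 {d : ℕ} (hd : 2 ≤ d) (Om : Set (EuclideanSpace ℝ (Fin d)))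
    (hOmc : IsCompact Om) (hOmi : (interior Om).Nonempty)
    (α β : EuclideanSpace ℝ (Fin d) → ℝ)
    (hαc : Continuous α) (hα0 : ∀ x, 0 ≤ α x)
    (hβc : Continuous β) (hβ0 : ∀ x, 0 ≤ β x)
    (hvol : 0 < volW α Om) (hbd : 0 < bdW Om β (frontier Om))
    (hnorm : volW α Om + bdW Om β (frontier Om) = 1) :
    hJb Om α β ≤ hJt Om α β := by
  refine le_sInf ?_
  rintro r ⟨A, hAO, hA, hpos, hle, rfl⟩
  by_cases hc : volW α A + extBW Om β A ≤ 1 / 2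
  · exact sInf_le ⟨A, hAO, hA, hpos, hc, rfl⟩
  have hv := volW_add_volW_diff α hA.1 hAO
  have he := extBW_add_extBW_diff hOmc.isClosed hAO hA
  have hbtop : bdW Om β (frontier Om) ≠ ∞ :=
    ne_top_of_le_ne_top one_ne_top (le_add_self.trans hnorm.le)
  have hAB : extBW Om β A ≤ extBW Om β (Om \ A) := by
    have hAtop : extBW Om β A ≠ ∞ := ne_top_of_le_ne_top hbtop (le_self_add.trans he.le)
    refine (ENNReal.add_le_add_iff_left hAtop).1 ?_
    rw [he, ← ENNReal.add_halves (bdW Om β (frontier Om))]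
    exact add_le_add hle hle
  have hsmall : volW α (Om \ A) + extBW Om β (Om \ A) ≤ 1 / 2 := by
    by_contra! hlt
    have hsum := ENNReal.add_lt_add (not_le.1 hc) hlt
    rw [ENNReal.add_halves, add_add_add_comm, hv, he, hnorm] at hsum
    exact hsum.false
  calc hJb Om α β ≤ intBW Om α (Om \ A) / extBW Om β (Om \ A) :=
        sInf_le ⟨Om \ A, sdiff_subset, hA.diff hOmc.measurableSet hAO, hpos.trans_le hAB,
          hsmall, rfl⟩
    _ = intBW Om α A / extBW Om β (Om \ A) := by rw [intBW, intB_diff, ← intBW]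
    _ ≤ intBW Om α A / extBW Om β A := ENNReal.div_le_div_left hAB _
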